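/- arXiv:0810.0777 — 2 statements merged into one kernel-verified Lean document; each statement's English description precedes it below -/
import Mathlib

section
/- Let α be a real number and 0 < δ < 1 be such that q·‖αq‖ ≥ δ for every positive integer q. Then for any natural numbers Q > q ≥ 2, the sum σ(α; q, Q) = Σ_{x=q}^{Q−1} 1/(‖αx‖·x·(log₂ x)²) satisfies σ(α; q, Q) ≤ 2⁸·δ⁻¹·( log₂( (log₂ Q)/(log₂ q) ) + log₂(1/δ) ). -/
/-- Distance from a real number to the nearest integer. -/
noncomputable def nint (t : ℝ) : ℝ := |t - round t|

lemma nint_nonneg (t : ℝ) : 0 ≤ nint t := abs_nonneg _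

lemma nint_le_abs_sub_intCast (t : ℝ) (z : ℤ) : nint t ≤ |t - z| := round_le t z

/-- The harmonic sum over distinct natural numbers, truncated at `N`. -/
lemma sum_one_div_add_one_le_harmonic {ι : Type*} (S : Finset ι) (j : ι → ℕ)
    (hj : Set.InjOn j S) (N : ℕ) :
    ∑ x ∈ S, 1 / ((j x : ℝ) + 1) ≤ (harmonic N : ℝ) + S.card * (1 / ((N : ℝ) + 1)) := by
  rw [← Finset.sum_filter_add_sum_filter_not S (fun x => j x < N)]
  gcongr ?_ + ?_
  · rw [← Finset.sum_image (f := fun n : ℕ => 1 / ((n : ℝ) + 1)) (g := j)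
      (fun x hx y hy h => hj (Finset.mem_filter.1 hx).1 (Finset.mem_filter.1 hy).1 h)]
    have : (harmonic N : ℝ) = ∑ n ∈ Finset.range N, 1 / ((n : ℝ) + 1) := by
      simp [harmonic]
    rw [this]
    apply Finset.sum_le_sum_of_subset_of_nonneg
    · intro n hn
      obtain ⟨x, hx, rfl⟩ := Finset.mem_image.1 hn
      exact Finset.mem_range.2 (Finset.mem_filter.1 hx).2
    · intros; positivity
  · calc _ ≤ ∑ x ∈ S with ¬ j x < N, 1 / ((N : ℝ) + 1) := by
          apply Finset.sum_le_sum
          intro x hx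
          have : N ≤ j x := not_lt.1 (Finset.mem_filter.1 hx).2
          gcongr
      _ ≤ ∑ x ∈ S, 1 / ((N : ℝ) + 1) := by
          apply Finset.sum_le_sum_of_subset_of_nonneg (Finset.filter_subset _ _)
          intros; positivity
      _ = _ := by simp

/-- For `α` badly approximable, distinct `x, y` with `|x - y| < N` have signed fractional parts of
`α x` and `α y` in different cells of length `δ / N`. -/
lemma injOn_floor_fractional_part {α δ : ℝ} (hδ0 : 0 < δ)
    (hbad : ∀ n : ℕ, 0 < n → δ ≤ (n : ℝ) * nint (α * n)) (N : ℕ) :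
    Set.InjOn (fun x : ℕ => ⌊(α * x - round (α * x)) * (N / δ)⌋)
      (Finset.Ico N (2 * N) : Set ℕ) := by
  have key : ∀ x y : ℕ, N ≤ x → x < y → y < 2 * N →
      ⌊(α * x - round (α * x)) * (N / δ)⌋ ≠ ⌊(α * y - round (α * y)) * (N / δ)⌋ := by
    intro x y hx hxy hy h
    have h1 := Int.abs_sub_lt_one_of_floor_eq_floor h
    have hN : (0 : ℝ) < N := by
      have : 0 < N := by omega
      exact_mod_cast this
    have h2 := hbad (y - x) (by omega)
    rw [Nat.cast_sub hxy.le] at h2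
    have h3 := nint_le_abs_sub_intCast (α * ((y : ℝ) - x)) (round (α * y) - round (α * x))
    have h4 : ((y : ℝ) - x) < N := by
      have : (y : ℝ) < x + N := by
        have : y < x + N := by omega
        exact_mod_cast this
      linarith
    have h0 : (0 : ℝ) < y - x := by
      have : (x : ℝ) < y := by exact_mod_cast hxy
      linarith
    rw [← sub_mul, abs_mul, abs_of_pos (by positivity : 0 < (N : ℝ) / δ), ← mul_div_assoc,
      div_lt_one hδ0, abs_sub_comm] at h1
    have h5 : α * ((y : ℝ) - x) - ((round (α * y) - round (α * x) : ℤ) : ℝ)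
        = α * y - round (α * y) - (α * x - round (α * x)) := by
      push_cast; ring
    rw [h5] at h3
    have h6 := mul_le_mul h4.le h3 (nint_nonneg _) hN.le
    linarith
  intro x hx y hy h
  simp only [Finset.coe_Ico, Set.mem_Ico] at hx hy
  rcases lt_trichotomy x y with hlt | heq | hgt
  · exact absurd h (key x y hx.1 hlt hy.2)
  · exact heq
  · exact absurd h.symm (key y x hy.1 hgt hx.2)

lemma sum_one_div_nint_le {α δ : ℝ} (hδ0 : 0 < δ)
    (hbad : ∀ n : ℕ, 0 < n → δ ≤ (n : ℝ) * nint (α * n)) {N : ℕ} (hN : 0 < N) :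
    ∑ x ∈ Finset.Ico N (2 * N), 1 / nint (α * x) ≤ 2 * N / δ * (2 * harmonic N + 1) := by
  have hN' : (0 : ℝ) < N := by exact_mod_cast hN
  set r : ℕ → ℝ := fun x => (α * x - round (α * x)) * (N / δ) with hr
  set m : ℕ → ℤ := fun x => ⌊r x⌋
  have hinj : Set.InjOn m (Finset.Ico N (2 * N) : Set ℕ) :=
    injOn_floor_fractional_part hδ0 hbad N
  have habs : ∀ x, |r x| = nint (α * x) * (N / δ) := by
    intro x
    simp only [hr, nint]
    rw [abs_mul, abs_of_pos (by positivity : 0 < (N : ℝ) / δ)]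
  have hhalf : ∀ x ∈ Finset.Ico N (2 * N), 1 / 2 ≤ |r x| := by
    intro x hx
    have hx' := Finset.mem_Ico.1 hx
    have h1 := hbad x (by omega)
    have h2 : (x : ℝ) ≤ 2 * N := by exact_mod_cast hx'.2.le
    have h3 := mul_le_mul_of_nonneg_right h2 (nint_nonneg (α * x))
    rw [habs, ← mul_div_assoc, le_div_iff₀ hδ0]
    linarith
  have hterm : ∀ x ∈ Finset.Ico N (2 * N), ∀ j : ℕ, ((j : ℝ) + 1) / 2 ≤ |r x| →
      1 / nint (α * x) ≤ 2 * N / δ * (1 / ((j : ℝ) + 1)) := by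
    intro x hx j hj
    have hpos : 0 < |r x| := by linarith [hhalf x hx]
    have : 1 / nint (α * x) = N / δ * (1 / |r x|) := by
      rw [habs] at hpos ⊢
      have : nint (α * x) ≠ 0 := by rintro h; simp [h] at hpos
      field_simp
    rw [this]
    have h2 : 1 / |r x| ≤ 1 / (((j : ℝ) + 1) / 2) := by gcongr
    calc (N : ℝ) / δ * (1 / |r x|) ≤ N / δ * (1 / (((j : ℝ) + 1) / 2)) := by gcongr
      _ = _ := by field_simp
  have hpos : ∑ x ∈ Finset.Ico N (2 * N) with 0 ≤ m x, 1 / nint (α * x) ≤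
      2 * N / δ * (harmonic N + (Finset.card {x ∈ Finset.Ico N (2 * N) | 0 ≤ m x}) *
        (1 / ((N : ℝ) + 1))) := by
    refine le_trans ?_ (mul_le_mul_of_nonneg_left
      (sum_one_div_add_one_le_harmonic _ (fun x => (m x).toNat) ?_ N) (by positivity))
    · rw [Finset.mul_sum]
      refine Finset.sum_le_sum fun x hx => ?_
      obtain ⟨hx, h0⟩ := Finset.mem_filter.1 hx
      refine hterm x hx _ ?_
      have h1 : (((m x).toNat : ℤ) : ℝ) = m x := by rw [Int.toNat_of_nonneg h0]
      rw [Int.cast_natCast] at h1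
      rw [h1]
      rcases h0.eq_or_lt with h | h
      · rw [← h]; simpa using hhalf x hx
      · have h2 : (1 : ℝ) ≤ m x := by exact_mod_cast h
        have h3 : (m x : ℝ) ≤ r x := Int.floor_le _
        linarith [le_abs_self (r x)]
    · intro x hx y hy h
      obtain ⟨hx, hx0⟩ := Finset.mem_filter.1 hx
      obtain ⟨hy, hy0⟩ := Finset.mem_filter.1 hy
      exact hinj hx hy (by simp only at h; omega)
  have hneg : ∑ x ∈ Finset.Ico N (2 * N) with ¬ 0 ≤ m x, 1 / nint (α * x) ≤
      2 * N / δ * (harmonic N + (Finset.card {x ∈ Finset.Ico N (2 * N) | ¬ 0 ≤ m x}) *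
        (1 / ((N : ℝ) + 1))) := by
    refine le_trans ?_ (mul_le_mul_of_nonneg_left
      (sum_one_div_add_one_le_harmonic _ (fun x => (-m x - 1).toNat) ?_ N) (by positivity))
    · rw [Finset.mul_sum]
      refine Finset.sum_le_sum fun x hx => ?_
      obtain ⟨hx, h0⟩ := Finset.mem_filter.1 hx
      refine hterm x hx _ ?_
      have h1 : (((-m x - 1).toNat : ℤ) : ℝ) = -m x - 1 := by
        rw [Int.toNat_of_nonneg (by omega)]; push_cast; ring
      rw [Int.cast_natCast] at h1
      rw [h1]
      rcases (show m x ≤ -1 by omega).eq_or_lt with h | h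
      · rw [h]; norm_num; simpa using hhalf x hx
      · have h2 : (m x : ℝ) ≤ -2 := by exact_mod_cast (show m x ≤ -2 by omega)
        have h3 : r x < m x + 1 := Int.lt_floor_add_one _
        linarith [neg_abs_le (r x)]
    · intro x hx y hy h
      obtain ⟨hx, hx0⟩ := Finset.mem_filter.1 hx
      obtain ⟨hy, hy0⟩ := Finset.mem_filter.1 hy
      exact hinj hx hy (by simp only at h; omega)
  rw [← Finset.sum_filter_add_sum_filter_not (Finset.Ico N (2 * N)) (fun x => 0 ≤ m x)]
  refine (add_le_add hpos hneg).trans ?_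
  rw [← mul_add]
  refine mul_le_mul_of_nonneg_left ?_ (by positivity)
  have hcard : ((Finset.card {x ∈ Finset.Ico N (2 * N) | 0 ≤ m x} : ℕ) : ℝ) +
      (Finset.card {x ∈ Finset.Ico N (2 * N) | ¬ 0 ≤ m x} : ℕ) = N := by
    rw [← Nat.cast_add, Finset.card_filter_add_card_filter_not, Nat.card_Ico]
    congr 1; omega
  have h1 : (N : ℝ) * (1 / ((N : ℝ) + 1)) ≤ 1 := by
    rw [mul_one_div, div_le_one (by positivity)]; linarith
  rw [← hcard, add_mul, hcard] at h1
  linarith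

lemma sum_Icc_one_div_le {K : ℕ} (hK : 0 < K) {M : ℕ} (hKM : K ≤ M) :
    ∑ k ∈ Finset.Icc K M, 1 / (k : ℝ) ≤ 1 + Real.log (M / K) := by
  have hK' : (1 : ℝ) ≤ K := by exact_mod_cast hK
  induction M, hKM using Nat.le_induction with
  | base =>
    have : (K : ℝ) ≠ 0 := by positivity
    simp [div_self this]
    exact inv_le_one_of_one_le₀ hK'
  | succ n hn ih =>
    have hn' : (0 : ℝ) < n := by exact_mod_cast hK.trans_le hn
    rw [← Finset.insert_Icc_right_eq_Icc_add_one (by omega), Finset.sum_insert (by simp)]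
    have h := Real.log_le_sub_one_of_pos (show (0 : ℝ) < n / (n + 1) by positivity)
    rw [Real.log_div (by positivity) (by positivity)] at ih h ⊢
    push_cast
    have h2 : (n : ℝ) / (n + 1) = 1 - 1 / (n + 1) := by field_simp; ring
    linarith

lemma sum_dyadic_block_le {α δ : ℝ} (hδ0 : 0 < δ)
    (hbad : ∀ n : ℕ, 0 < n → δ ≤ (n : ℝ) * nint (α * n)) {k : ℕ} (hk : 0 < k) :
    ∑ x ∈ (Finset.Ico (2 ^ k) (2 * 2 ^ k) : Finset ℕ), 1 / (nint (α * x) * x * (Real.logb 2 x) ^ 2)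
      ≤ 10 * δ⁻¹ * (1 / (k : ℝ)) := by
  have hk' : (1 : ℝ) ≤ k := by exact_mod_cast hk
  have hh : (harmonic (2 ^ k) : ℝ) ≤ 1 + k := by
    have h := harmonic_le_one_add_log (2 ^ k)
    push_cast at h
    rw [Real.log_pow] at h
    nlinarith [Real.log_two_lt_d9]
  have hblock := sum_one_div_nint_le hδ0 hbad (N := 2 ^ k) (by positivity)
  push_cast at hblock
  calc _ ≤ ∑ x ∈ (Finset.Ico (2 ^ k) (2 * 2 ^ k) : Finset ℕ),
        1 / ((2 : ℝ) ^ k * (k : ℝ) ^ 2) * (1 / nint (α * x)) := by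
        refine Finset.sum_le_sum fun x hx => ?_
        have hx' := (Finset.mem_Ico.1 hx).1
        have h1 : (2 : ℝ) ^ k ≤ x := by exact_mod_cast hx'
        have hxpos : 0 < x := lt_of_lt_of_le (by positivity) hx'
        have h2 : (k : ℝ) ≤ Real.logb 2 x := by
          rw [Real.le_logb_iff_rpow_le (by norm_num) (by exact_mod_cast hxpos)]
          simpa using h1
        have h3 : 0 < nint (α * x) := by
          have := hbad x hxpos
          have hxr : (0 : ℝ) < x := by exact_mod_cast hxpos
          by_contra h
          nlinarith
        rw [one_div_mul_one_div]
        have : nint (α * x) * x * (Real.logb 2 x) ^ 2 =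
          x * (Real.logb 2 x) ^ 2 * nint (α * x) := by ring
        rw [this]
        gcongr
    _ ≤ 1 / ((2 : ℝ) ^ k * (k : ℝ) ^ 2) * (2 * 2 ^ k / δ * (5 * k)) := by
        rw [← Finset.mul_sum]
        gcongr
        refine hblock.trans ?_
        gcongr
        linarith
    _ = _ := by field_simp; norm_num

theorem sigma_sum_bound
    (α δ : ℝ) (hδ0 : 0 < δ) (hδ1 : δ < 1)
    (hbad : ∀ n : ℕ, 0 < n → δ ≤ (n : ℝ) * nint (α * n))
    (q Q : ℕ) (hq : 2 ≤ q) (hqQ : q < Q) :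
    ∑ x ∈ Finset.Ico q Q, 1 / (nint (α * x) * x * (Real.logb 2 x) ^ 2)
      ≤ 2 ^ 8 * δ⁻¹ *
        (Real.logb 2 (Real.logb 2 Q / Real.logb 2 q) + Real.logb 2 (1 / δ)) := by
  set f : ℕ → ℝ := fun x => 1 / (nint (α * x) * x * (Real.logb 2 x) ^ 2) with hf
  have hf0 : ∀ x, 0 ≤ f x := fun x => by
    have := nint_nonneg (α * x)
    simp only [hf]; positivity
  set K := Nat.log 2 q
  set M := Nat.log 2 Q
  have hK : 0 < K := Nat.log_pos (by norm_num) hq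
  have hKM : K ≤ M := Nat.log_mono_right hqQ.le
  have hsum : ∑ x ∈ Finset.Ico q Q, f x ≤ 10 * δ⁻¹ * (1 + Real.log (M / K)) := by
    rw [← Finset.sum_fiberwise_of_maps_to (s := Finset.Ico q Q) (t := Finset.Icc K M)
      (g := Nat.log 2) (fun x hx => Finset.mem_Icc.2
        ⟨Nat.log_mono_right (Finset.mem_Ico.1 hx).1,
          Nat.log_mono_right (Finset.mem_Ico.1 hx).2.le⟩)]
    refine le_trans ?_ (mul_le_mul_of_nonneg_left (sum_Icc_one_div_le hK hKM) (by positivity))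
    rw [Finset.mul_sum]
    refine Finset.sum_le_sum fun k hk => ?_
    refine le_trans (Finset.sum_le_sum_of_subset_of_nonneg ?_ fun x _ _ => hf0 x)
      (sum_dyadic_block_le hδ0 hbad (hK.trans_le (Finset.mem_Icc.1 hk).1))
    intro x hx
    obtain ⟨hxq, rfl⟩ := Finset.mem_filter.1 hx
    have hqx := (Finset.mem_Ico.1 hxq).1
    rw [Finset.mem_Ico, ← pow_succ']
    exact ⟨Nat.pow_log_le_self 2 (by omega), Nat.lt_pow_succ_log_self (by norm_num) x⟩
  have hδhalf : δ ≤ 1 / 2 := by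
    have h := hbad 1 one_pos
    have h2 : nint (α * (1 : ℕ)) ≤ 1 / 2 := abs_sub_round _
    rw [Nat.cast_one, one_mul] at h
    rw [Nat.cast_one] at h2
    exact h.trans h2
  have hlogδ : 1 ≤ Real.logb 2 (1 / δ) := by
    rw [Real.le_logb_iff_rpow_le (by norm_num) (by positivity), Real.rpow_one,
      le_div_iff₀ hδ0]
    linarith
  have hqr : (2 : ℝ) ≤ q := by exact_mod_cast hq
  have hqQr : (q : ℝ) ≤ Q := by exact_mod_cast hqQ.le
  have hlq : 1 ≤ Real.logb 2 q := by
    rw [Real.le_logb_iff_rpow_le (by norm_num) (by positivity), Real.rpow_one]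
    exact hqr
  have hlqQ : Real.logb 2 q ≤ Real.logb 2 Q :=
    Real.logb_le_logb_of_le (by norm_num) (by positivity) hqQr
  have hK1 : (1 : ℝ) ≤ K := by exact_mod_cast hK
  have hM : (M : ℝ) ≤ Real.logb 2 Q := Real.natLog_le_logb Q 2
  have hq2 : Real.logb 2 q ≤ 2 * K := by
    have h : Real.logb 2 q ≤ K + 1 := by
      rw [Real.logb_le_iff_le_rpow (by norm_num) (by positivity)]
      exact_mod_cast (Nat.lt_pow_succ_log_self (by norm_num : 1 < 2) q).le
    linarith
  set L := Real.logb 2 Q / Real.logb 2 q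
  have hL : 1 ≤ L := (one_le_div (by linarith)).2 hlqQ
  have hML : (M : ℝ) / K ≤ 2 * L := by
    rw [div_le_iff₀ (by linarith)]
    calc (M : ℝ) ≤ L * Real.logb 2 q := by
          rw [div_mul_cancel₀ _ (by linarith)]; exact hM
      _ ≤ L * (2 * K) := by gcongr
      _ = _ := by ring
  have hlb : 0 ≤ Real.logb 2 L := Real.logb_nonneg (by norm_num) hL
  have hM1 : (1 : ℝ) ≤ M := by exact_mod_cast hK.trans_le hKM
  have hlog : Real.log (M / K) ≤ 1 + Real.logb 2 L := by
    refine (Real.log_le_log (by positivity) hML).trans ?_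
    have h2 : Real.log L = Real.logb 2 L * Real.log 2 :=
      (div_mul_cancel₀ _ (Real.log_pos one_lt_two).ne').symm
    rw [Real.log_mul (by norm_num) (by linarith), h2]
    nlinarith [Real.log_two_lt_d9]
  have hδi : 0 ≤ δ⁻¹ := by positivity
  calc _ ≤ 10 * δ⁻¹ * (1 + Real.log (M / K)) := hsum
    _ = δ⁻¹ * (10 * (1 + Real.log (M / K))) := by ring
    _ ≤ δ⁻¹ * (2 ^ 8 * (Real.logb 2 L + Real.logb 2 (1 / δ))) :=
        mul_le_mul_of_nonneg_left (by linarith) hδi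
    _ = _ := by ring
end

section
/- Let α be badly approximable with constant δ (0 < δ < 1) and let ε > 0. For q₀ large enough the following holds for every integer q ≥ q₀ and every integer x ≥ q³: mes(B_q ∩ A(x)) ≤ (2⁴·ε/(‖αx‖·x·(log₂ x)²))·mes(B_q). -/
open MeasureTheory

/-- The "dangerous" neighbourhood `E(x)` of rationals with denominator `x`:
`E(x) = (⋃_{y=0}^{x} [y/x − ε/(‖αx‖x²log₂²x), y/x + ε/(‖αx‖x²log₂²x)]) ∩ [0,1]`. -/
noncomputable def Eset (α ε : ℝ) (x : ℕ) : Set ℝ :=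
  (⋃ y ∈ Finset.range (x + 1),
      Set.Icc ((y : ℝ) / x - ε / (nint (α * x) * (x : ℝ) ^ 2 * (Real.logb 2 x) ^ 2))
              ((y : ℝ) / x + ε / (nint (α * x) * (x : ℝ) ^ 2 * (Real.logb 2 x) ^ 2)))
    ∩ Set.Icc 0 1

/-- The dyadic scale `l_x = ⌊log₂(‖αx‖ x² log₂² x / (2ε))⌋`. -/
noncomputable def lx (α ε : ℝ) (x : ℕ) : ℤ :=
  ⌊Real.logb 2 (nint (α * x) * (x : ℝ) ^ 2 * (Real.logb 2 x) ^ 2 / (2 * ε))⌋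

/-- `A(x)`: the union of all dyadic intervals of length `2^{-l_x}` at scale `l_x`
that meet `E(x)` (the smallest union of such intervals covering `E(x)`). -/
noncomputable def Aset (α ε : ℝ) (x : ℕ) : Set ℝ :=
  ⋃ a : ℤ, ⋃ _ : (Set.Icc ((a : ℝ) / (2 : ℝ) ^ lx α ε x) (((a : ℝ) + 1) / (2 : ℝ) ^ lx α ε x)
      ∩ Eset α ε x).Nonempty,
    Set.Icc ((a : ℝ) / (2 : ℝ) ^ lx α ε x) (((a : ℝ) + 1) / (2 : ℝ) ^ lx α ε x)

/-- `A^c(x) = [0,1] \ A(x)`. -/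
noncomputable def Acset (α ε : ℝ) (x : ℕ) : Set ℝ := Set.Icc 0 1 \ Aset α ε x

/-- `B_q = ⋂_{x=q₀}^{q} A^c(x)`. -/
noncomputable def Bset (α ε : ℝ) (q₀ q : ℕ) : Set ℝ := ⋂ x ∈ Finset.Icc q₀ q, Acset α ε x

/-- An open dyadic cell of level `L` is either contained in
`Aset α ε x` or disjoint from it, provided `lx α ε x ≤ L`. -/
lemma Ioo_subset_or_disjoint_Aset {α ε : ℝ} {x L : ℕ} (hL : lx α ε x ≤ L) (k : ℕ) :
    Set.Ioo ((k : ℝ) / 2 ^ L) (((k : ℝ) + 1) / 2 ^ L) ⊆ Aset α ε x ∨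
      Disjoint (Set.Ioo ((k : ℝ) / 2 ^ L) (((k : ℝ) + 1) / 2 ^ L)) (Aset α ε x) := by
  by_cases hd : Disjoint (Set.Ioo ((k : ℝ) / 2 ^ L) (((k : ℝ) + 1) / 2 ^ L)) (Aset α ε x)
  · exact Or.inr hd
  left
  obtain ⟨t, ⟨ht1, ht2⟩, htA⟩ := Set.not_disjoint_iff.1 hd
  simp only [Aset, Set.mem_iUnion] at htA
  obtain ⟨a, hne, hta1, hta2⟩ := htA
  obtain ⟨m, hm⟩ := Int.le.dest hL
  have hpow : (2 : ℝ) ^ L = (2 : ℝ) ^ lx α ε x * 2 ^ m := by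
    rw [← zpow_natCast, ← zpow_natCast, ← hm, zpow_add₀ (by norm_num)]
  have hl : (0 : ℝ) < (2 : ℝ) ^ lx α ε x := by positivity
  have hm0 : (0 : ℝ) < (2 : ℝ) ^ m := by positivity
  have hN : (0 : ℝ) < (2 : ℝ) ^ L := by positivity
  have hleft : (a : ℝ) / (2 : ℝ) ^ lx α ε x = ((a * 2 ^ m : ℤ) : ℝ) / 2 ^ L := by
    rw [hpow]; push_cast; field_simp
  have hright : ((a : ℝ) + 1) / (2 : ℝ) ^ lx α ε x = (((a + 1) * 2 ^ m : ℤ) : ℝ) / 2 ^ L := by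
    rw [hpow]; push_cast; field_simp
  have h1 : a * 2 ^ m < (k : ℤ) + 1 := by
    have := (div_lt_div_iff_of_pos_right hN).1 ((hleft ▸ hta1).trans_lt ht2)
    exact_mod_cast this
  have h2 : (k : ℤ) < (a + 1) * 2 ^ m := by
    have := (div_lt_div_iff_of_pos_right hN).1 (ht1.trans_le (hright ▸ hta2))
    exact_mod_cast this
  have h1' : ((a * 2 ^ m : ℤ) : ℝ) ≤ k := by exact_mod_cast Int.lt_add_one_iff.1 h1
  have h2' : (k : ℝ) + 1 ≤ (((a + 1) * 2 ^ m : ℤ) : ℝ) := by exact_mod_cast h2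
  intro s hs
  simp only [Aset, Set.mem_iUnion]
  refine ⟨a, hne, ?_, ?_⟩
  · rw [hleft]
    exact (div_le_div_of_nonneg_right h1' hN.le).trans hs.1.le
  · rw [hright]
    exact hs.2.le.trans (div_le_div_of_nonneg_right h2' hN.le)

/-- An open dyadic cell of level `L` inside `[0,1]` is contained in `Bset α ε q₀ q` or disjoint
from it, if `L` dominates all the scales involved. -/
lemma Ioo_subset_or_disjoint_Bset {α ε : ℝ} {q₀ q L : ℕ}
    (hL : ∀ x ∈ Finset.Icc q₀ q, lx α ε x ≤ L) {k : ℕ} (hk : k < 2 ^ L) :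
    Set.Ioo ((k : ℝ) / 2 ^ L) (((k : ℝ) + 1) / 2 ^ L) ⊆ Bset α ε q₀ q ∨
      Disjoint (Set.Ioo ((k : ℝ) / 2 ^ L) (((k : ℝ) + 1) / 2 ^ L)) (Bset α ε q₀ q) := by
  by_cases h : ∀ x ∈ Finset.Icc q₀ q,
      Disjoint (Set.Ioo ((k : ℝ) / 2 ^ L) (((k : ℝ) + 1) / 2 ^ L)) (Aset α ε x)
  · left
    have hk' : (k : ℝ) + 1 ≤ 2 ^ L := by exact_mod_cast hk
    refine Set.subset_iInter₂ fun x hx t ht => ⟨⟨?_, ?_⟩, ?_⟩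
    · exact le_trans (by positivity) ht.1.le
    · exact ht.2.le.trans ((div_le_one (by positivity)).2 hk')
    · exact Set.disjoint_left.1 (h x hx) ht
  · right
    push Not at h
    obtain ⟨x, hx, hnd⟩ := h
    have hsub := (Ioo_subset_or_disjoint_Aset (hL x hx) k).resolve_right hnd
    exact Set.disjoint_left.2 fun t ht htB => (Set.mem_iInter₂.1 htB x hx).2 (hsub ht)

/-- Points of `Aset α ε x` are close to fractions with denominator `x`. -/
lemma exists_abs_sub_div_le_of_mem_Aset {α ε : ℝ} {x : ℕ} {D : ℝ}
    (hD : D = nint (α * x) * (x : ℝ) ^ 2 * (Real.logb 2 x) ^ 2) (hD0 : 0 < D) (hε : 0 < ε)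
    {t : ℝ} (ht : t ∈ Aset α ε x) : ∃ y : ℤ, |t - y / x| ≤ 5 * ε / D := by
  simp only [Aset, Set.mem_iUnion] at ht
  obtain ⟨a, ⟨s, ⟨hs1, hs2⟩, hsE, -⟩, ht1, ht2⟩ := ht
  simp only [Set.mem_iUnion] at hsE
  obtain ⟨y, -, hy1, hy2⟩ := hsE
  rw [← hD] at hy1 hy2
  have hl : (0 : ℝ) < (2 : ℝ) ^ lx α ε x := by positivity
  have hlt : D / (2 * ε) < (2 : ℝ) ^ lx α ε x * 2 := by
    have h := Int.lt_floor_add_one (Real.logb 2 (D / (2 * ε)))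
    rw [Real.logb_lt_iff_lt_rpow (by norm_num) (by positivity), Real.rpow_add (by norm_num),
      Real.rpow_intCast, Real.rpow_one] at h
    rwa [lx, ← hD]
  have hh : 1 / (2 : ℝ) ^ lx α ε x ≤ 4 * ε / D := by
    rw [div_lt_iff₀ (by positivity)] at hlt
    rw [div_le_div_iff₀ hl hD0]
    linarith
  have hcell : ((a : ℝ) + 1) / (2 : ℝ) ^ lx α ε x
      = a / (2 : ℝ) ^ lx α ε x + 1 / (2 : ℝ) ^ lx α ε x := add_div _ _ _
  have h5 : 5 * ε / D = 4 * ε / D + ε / D := by ring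
  refine ⟨y, ?_⟩
  rw [Int.cast_natCast, abs_le]
  constructor <;> linarith

/-- The part of `Aset α ε x` in an interval that is long compared with `1 / x`. -/
lemma volume_Icc_inter_Aset_le {α ε : ℝ} {x : ℕ} {D : ℝ} (hx : 0 < x)
    (hD : D = nint (α * x) * (x : ℝ) ^ 2 * (Real.logb 2 x) ^ 2) (hε : 0 < ε)
    (hxD : 5 * ε * x ≤ D) {u v : ℝ} (huv : 5 ≤ x * (v - u)) :
    volume (Set.Icc u v ∩ Aset α ε x) ≤ ENNReal.ofReal (2 ^ 4 * ε * x / D * (v - u)) := by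
  have hx0 : (0 : ℝ) < x := by exact_mod_cast hx
  have hD0 : 0 < D := lt_of_lt_of_le (by positivity) hxD
  set ρ : ℝ := 5 * ε / D with hρ
  have hρ0 : 0 < ρ := by positivity
  have hxρ : x * ρ ≤ 1 := by
    rw [hρ, mul_div_assoc', div_le_one hD0]; linarith
  set S : Finset ℤ := Finset.Icc ⌈x * u - 1⌉ ⌊x * v + 1⌋ with hS
  have hsub : Set.Icc u v ∩ Aset α ε x ⊆ ⋃ y ∈ S, Set.Icc ((y : ℝ) / x - ρ) (y / x + ρ) := by
    rintro t ⟨⟨hu, hv⟩, htA⟩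
    obtain ⟨y, hy⟩ := exists_abs_sub_div_le_of_mem_Aset hD hD0 hε htA
    rw [← hρ, abs_le] at hy
    have hxy : x * ((y : ℝ) / x) = y := by field_simp
    refine Set.mem_iUnion₂.2 ⟨y, ?_, by linarith [hy.2], by linarith [hy.1]⟩
    rw [hS, Finset.mem_Icc, Int.ceil_le, Int.le_floor]
    constructor
    · have := mul_le_mul_of_nonneg_left (show u - ρ ≤ (y : ℝ) / x by linarith [hy.2]) hx0.le
      rw [hxy] at this; linarith
    · have := mul_le_mul_of_nonneg_left (show (y : ℝ) / x ≤ v + ρ by linarith [hy.1]) hx0.le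
      rw [hxy] at this; linarith
  have hcard : (S.card : ℝ) ≤ x * (v - u) + 3 := by
    rw [hS, Int.card_Icc]
    have h1 := Int.le_ceil ((x : ℝ) * u - 1)
    have h2 := Int.floor_le ((x : ℝ) * v + 1)
    have h3 : (((⌊x * v + 1⌋ + 1 - ⌈x * u - 1⌉).toNat : ℤ) : ℝ)
        = ((max (⌊x * v + 1⌋ + 1 - ⌈x * u - 1⌉) 0 : ℤ) : ℝ) := by rw [Int.toNat_eq_max]
    rw [Int.cast_natCast] at h3
    rw [h3, Int.cast_max]
    push_cast
    exact max_le (by linarith) (by linarith)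
  calc volume (Set.Icc u v ∩ Aset α ε x)
      ≤ volume (⋃ y ∈ S, Set.Icc ((y : ℝ) / x - ρ) (y / x + ρ)) := measure_mono hsub
    _ ≤ ∑ y ∈ S, volume (Set.Icc ((y : ℝ) / x - ρ) (y / x + ρ)) := measure_biUnion_finset_le _ _
    _ = ∑ _y ∈ S, ENNReal.ofReal (2 * ρ) := by
        refine Finset.sum_congr rfl fun y _ => ?_
        rw [Real.volume_Icc]; congr 1; ring
    _ = ENNReal.ofReal (S.card * (2 * ρ)) := by
        rw [Finset.sum_const, nsmul_eq_mul, ENNReal.ofReal_mul (Nat.cast_nonneg _),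
          ENNReal.ofReal_natCast]
    _ ≤ ENNReal.ofReal (2 ^ 4 * ε * x / D * (v - u)) := by
        apply ENNReal.ofReal_le_ofReal
        have h16 : 2 ^ 4 * ε * x / D * (v - u) = (8 / 5 * (x * (v - u))) * (2 * ρ) := by
          rw [hρ]; field_simp; ring
        rw [h16]
        exact mul_le_mul_of_nonneg_right (by linarith) (by positivity)

/-- A bound on the proportion of `A` in every open dyadic cell of level `L` contained in `B` gives
the same bound on the proportion of `A` in `B`, if `B ⊆ [0,1]` is a union of such cells up to
their endpoints. -/
lemma volume_inter_le_of_dyadic {A B : Set ℝ} (L : ℕ) (c : ENNReal) (hB01 : B ⊆ Set.Icc 0 1)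
    (hB : ∀ k : ℕ, k < 2 ^ L → Set.Ioo ((k : ℝ) / 2 ^ L) (((k : ℝ) + 1) / 2 ^ L) ⊆ B ∨
      Disjoint (Set.Ioo ((k : ℝ) / 2 ^ L) (((k : ℝ) + 1) / 2 ^ L)) B)
    (hA : ∀ k : ℕ, k < 2 ^ L → volume (Set.Ioo ((k : ℝ) / 2 ^ L) (((k : ℝ) + 1) / 2 ^ L) ∩ A)
      ≤ c * volume (Set.Ioo ((k : ℝ) / 2 ^ L) (((k : ℝ) + 1) / 2 ^ L))) :
    volume (B ∩ A) ≤ c * volume B := by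
  set I : ℕ → Set ℝ := fun k => Set.Ioo ((k : ℝ) / 2 ^ L) (((k : ℝ) + 1) / 2 ^ L)
  have hN : (0 : ℝ) < 2 ^ L := by positivity
  set G : Set ℝ := (fun k : ℕ => (k : ℝ) / 2 ^ L) '' Set.Iic (2 ^ L)
  have hG0 : volume G = 0 := ((Set.finite_Iic _).image _).measure_zero _
  have hcover : B ∩ A ⊆ (⋃ k ∈ Finset.range (2 ^ L), I k ∩ (B ∩ A)) ∪ G := by
    intro t ht
    obtain ⟨h0, h1⟩ := hB01 ht.1
    have hfl := Nat.floor_le (show 0 ≤ t * 2 ^ L by positivity)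
    have hlt := Nat.lt_floor_add_one (t * 2 ^ L)
    have htN : t * 2 ^ L ≤ 2 ^ L := by nlinarith
    have hle : ⌊t * 2 ^ L⌋₊ ≤ 2 ^ L := by exact_mod_cast hfl.trans htN
    rcases hfl.eq_or_lt with heq | hlt'
    · exact Or.inr ⟨_, hle, by simp only [heq]; field_simp⟩
    · left
      refine Set.mem_iUnion₂.2 ⟨⌊t * 2 ^ L⌋₊, ?_, ⟨?_, ?_⟩, ht⟩
      · have : (⌊t * 2 ^ L⌋₊ : ℝ) < 2 ^ L := hlt'.trans_le htN
        exact Finset.mem_range.2 (by exact_mod_cast this)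
      · exact (div_lt_iff₀ hN).2 hlt'
      · exact (lt_div_iff₀ hN).2 hlt
  have hcell : ∀ k ∈ Finset.range (2 ^ L),
      volume (I k ∩ (B ∩ A)) ≤ c * volume.restrict B (I k) := by
    intro k hk
    rw [Measure.restrict_apply measurableSet_Ioo]
    rcases hB k (Finset.mem_range.1 hk) with h | h
    · rw [Set.inter_eq_left.2 h]
      exact (measure_mono (Set.inter_subset_inter_right _ Set.inter_subset_right)).trans
        (hA k (Finset.mem_range.1 hk))
    · rw [← Set.inter_assoc, h.inter_eq, Set.empty_inter, measure_empty]
      exact zero_le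
  have hdisj : Set.PairwiseDisjoint (Finset.range (2 ^ L) : Set ℕ) I := by
    intro i _ j _ hij
    refine Set.disjoint_left.2 fun t hi hj => hij ?_
    have h1 := (div_lt_div_iff_of_pos_right hN).1 (hi.1.trans hj.2)
    have h2 := (div_lt_div_iff_of_pos_right hN).1 (hj.1.trans hi.2)
    have h1' : i < j + 1 := by exact_mod_cast h1
    have h2' : j < i + 1 := by exact_mod_cast h2
    omega
  calc volume (B ∩ A)
      ≤ volume (⋃ k ∈ Finset.range (2 ^ L), I k ∩ (B ∩ A)) + volume G :=
        (measure_mono hcover).trans (measure_union_le _ _)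
    _ ≤ ∑ k ∈ Finset.range (2 ^ L), volume (I k ∩ (B ∩ A)) := by
        rw [hG0, add_zero]; exact measure_biUnion_finset_le _ _
    _ ≤ ∑ k ∈ Finset.range (2 ^ L), c * volume.restrict B (I k) := Finset.sum_le_sum hcell
    _ = c * volume.restrict B (⋃ k ∈ Finset.range (2 ^ L), I k) := by
        rw [← Finset.mul_sum, measure_biUnion_finset hdisj fun _ _ => measurableSet_Ioo]
    _ ≤ c * volume B := by
        refine mul_le_mul' le_rfl ?_
        exact (measure_mono (Set.subset_univ _)).trans_eq (Measure.restrict_apply_univ B)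

/-- The scales up to `q` are at most that of `q ^ 3 / 5`, if `q` is large compared with
`(log₂ q) ^ 2`. -/
lemma lx_le_floor_logb {α ε : ℝ} (hε : 0 < ε) {x q : ℕ} (hx : 2 ≤ x) (hxq : x ≤ q)
    (hpos : 0 < nint (α * x)) (hq : (Real.logb 2 q) ^ 2 ≤ 2 * ε / 5 * q) :
    lx α ε x ≤ ⌊Real.logb 2 ((q : ℝ) ^ 3 / 5)⌋ := by
  have hx2 : (2 : ℝ) ≤ x := by exact_mod_cast hx
  have hxq' : (x : ℝ) ≤ q := by exact_mod_cast hxq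
  have hlogx : 0 < Real.logb 2 x := Real.logb_pos (by norm_num) (by linarith)
  have hlog : Real.logb 2 x ≤ Real.logb 2 q :=
    Real.logb_le_logb_of_le (by norm_num) (by linarith) hxq'
  have hnint : nint (α * x) ≤ 1 := (abs_sub_round _).trans (by norm_num)
  refine Int.floor_le_floor (Real.logb_le_logb_of_le (by norm_num) (by positivity) ?_)
  rw [div_le_iff₀ (by positivity)]
  calc nint (α * x) * (x : ℝ) ^ 2 * (Real.logb 2 x) ^ 2
      ≤ 1 * (q : ℝ) ^ 2 * (Real.logb 2 q) ^ 2 := by gcongr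
    _ ≤ 1 * (q : ℝ) ^ 2 * (2 * ε / 5 * q) := by gcongr
    _ = (q : ℝ) ^ 3 / 5 * (2 * ε) := by ring

lemma eventually_logb_sq_le {c : ℝ} (hc : 0 < c) :
    ∀ᶠ n : ℕ in Filter.atTop, (Real.logb 2 n) ^ 2 ≤ c * n := by
  have hlog2 : 0 < Real.log 2 := Real.log_pos (by norm_num)
  have h := (Real.isLittleO_pow_log_id_atTop (n := 2)).bound
    (show 0 < c * Real.log 2 ^ 2 by positivity)
  filter_upwards [tendsto_natCast_atTop_atTop.eventually h] with n hn
  rw [Real.norm_of_nonneg (by positivity), id, Real.norm_of_nonneg (by positivity)] at hn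
  rw [Real.logb, div_pow, div_le_iff₀ (by positivity)]
  linarith

lemma eventually_le_logb_sq (c : ℝ) :
    ∀ᶠ n : ℕ in Filter.atTop, c ≤ (Real.logb 2 n) ^ 2 :=
  (((Filter.tendsto_pow_atTop two_ne_zero).comp (Real.tendsto_logb_atTop (by norm_num))).comp
    tendsto_natCast_atTop_atTop).eventually_ge_atTop c

theorem Bset_intersect_Aset_measure_bound
    (α δ : ℝ) (hδ0 : 0 < δ) (hδ1 : δ < 1)
    (hbad : ∀ n : ℕ, 0 < n → δ ≤ (n : ℝ) * nint (α * n))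
    (ε : ℝ) (hε : 0 < ε) :
    ∃ Q₀ : ℕ, 2 ≤ Q₀ ∧ ∀ q₀ : ℕ, Q₀ ≤ q₀ → ∀ q : ℕ, q₀ ≤ q → ∀ x : ℕ, q ^ 3 ≤ x →
      volume (Bset α ε q₀ q ∩ Aset α ε x)
        ≤ ENNReal.ofReal (2 ^ 4 * ε / (nint (α * x) * (x : ℝ) * (Real.logb 2 x) ^ 2))
          * volume (Bset α ε q₀ q) := by
  obtain ⟨Q, hQ⟩ := Filter.eventually_atTop.1
    ((eventually_logb_sq_le (show 0 < 2 * ε / 5 by positivity)).and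
      (eventually_le_logb_sq (5 * ε / δ)))
  refine ⟨max 2 Q, le_max_left _ _, fun q₀ hq₀ q hq x hx => ?_⟩
  have hq2 : 2 ≤ q := (le_max_left 2 Q).trans (hq₀.trans hq)
  have hQq : Q ≤ q := (le_max_right 2 Q).trans (hq₀.trans hq)
  have hqx : q ≤ x := (Nat.le_self_pow (by norm_num) q).trans hx
  have hx0 : 0 < x := by omega
  have hxR : (0 : ℝ) < x := by exact_mod_cast hx0
  have hq2R : (2 : ℝ) ≤ q := by exact_mod_cast hq2
  have hx3 : (q : ℝ) ^ 3 ≤ x := by exact_mod_cast hx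
  have hnint : ∀ n : ℕ, 0 < n → 0 < nint (α * n) := fun n hn =>
    pos_of_mul_pos_right (hδ0.trans_le (hbad n hn)) (Nat.cast_nonneg n)
  have hM : (1 : ℝ) ≤ (q : ℝ) ^ 3 / 5 := by
    have : (2 : ℝ) ^ 3 ≤ (q : ℝ) ^ 3 := by gcongr
    linarith
  obtain ⟨L, hL⟩ := Int.eq_ofNat_of_zero_le
    (Int.floor_nonneg.2 (Real.logb_nonneg (by norm_num : (1 : ℝ) < 2) hM))
  have hLM : (2 : ℝ) ^ L ≤ (q : ℝ) ^ 3 / 5 := by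
    have h := Int.floor_le (Real.logb 2 ((q : ℝ) ^ 3 / 5))
    rw [hL, Int.cast_natCast, Real.le_logb_iff_rpow_le (by norm_num) (by linarith),
      Real.rpow_natCast] at h
    exact h
  have hscale : ∀ n ∈ Finset.Icc q₀ q, lx α ε n ≤ L := by
    intro n hn
    rw [Finset.mem_Icc] at hn
    have hn2 : 2 ≤ n := (le_max_left 2 Q).trans (hq₀.trans hn.1)
    exact hL ▸ lx_le_floor_logb hε hn2 hn.2 (hnint n (by omega)) (hQ q hQq).1
  have hxD : 5 * ε * x ≤ nint (α * x) * (x : ℝ) ^ 2 * (Real.logb 2 x) ^ 2 := by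
    calc 5 * ε * x = δ * x * (5 * ε / δ) := by field_simp
      _ ≤ (x * nint (α * x)) * x * (Real.logb 2 x) ^ 2 := by
          have h1 := hbad x hx0
          have h2 := (hQ x (hQq.trans hqx)).2
          have := hnint x hx0
          gcongr
      _ = _ := by ring
  refine volume_inter_le_of_dyadic L _ ?_
    (fun k hk => Ioo_subset_or_disjoint_Bset hscale hk) fun k hk => ?_
  · intro t ht
    exact (Set.mem_iInter₂.1 ht q (Finset.mem_Icc.2 ⟨hq, le_rfl⟩)).1
  · have hlen : 5 ≤ x * (((k : ℝ) + 1) / 2 ^ L - k / 2 ^ L) := by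
      rw [← sub_div, add_sub_cancel_left, mul_one_div, le_div_iff₀ (by positivity)]
      linarith
    have hpos := hnint x hx0
    rw [Real.volume_Ioo, ← ENNReal.ofReal_mul (by positivity)]
    refine (measure_mono (Set.inter_subset_inter_left _ Set.Ioo_subset_Icc_self)).trans
      ((volume_Icc_inter_Aset_le hx0 rfl hε hxD hlen).trans_eq ?_)
    congr 2
    rw [show nint (α * x) * (x : ℝ) ^ 2 * (Real.logb 2 x) ^ 2
      = (nint (α * x) * x * (Real.logb 2 x) ^ 2) * x by ring, mul_div_mul_right _ _ hxR.ne']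
end
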